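/- For each Y ∈ C̲_r one has τ(ε̲_Y) ∘ η̄_{τY} = Id̄_{τY}, and for each X ∈ C̄_l one has ε̲_{τ⁻X} ∘ τ⁻(η̄_X) = Id̲_{τ⁻X}. Hence (τ⁻, τ) is an adjoint pair of functors with unit η̄ and counit ε̲. -/

import Mathlib

/-!
Common setup: a Hom-finite Krull-Schmidt `k`-linear abelian category `C`, regarded as an exact
category whose conflations are all short exact sequences.  The Yoneda Ext¹-bifunctor of this
exact structure, together with the assignment of its extension class to each short exact
sequence and the standard pullback/pushout functorialities, is axiomatized by the structure
`YonedaExt` below.  (Over a field, Hom-finiteness together with the existence of an abelian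
structure makes `C` Krull-Schmidt automatically.)
-/

open CategoryTheory CategoryTheory.Limits

universe v u

namespace GenAR

/-- An axiomatization of the Yoneda `Ext¹`-bifunctor of a `k`-linear abelian category `C`
(with the exact structure given by all short exact sequences):  `ext X Y` is the `k`-module
of equivalence classes of conflations `Y → E → X`; `pull f Y` is `Ext(f,Y)` (pullback, i.e.
`μ ↦ μ.f`); `push X g` is `Ext(X,g)` (pushout, i.e. `μ ↦ g.μ`); `cls` assigns to a short
exact sequence its class, which vanishes iff the sequence splits; every class is realized by
a conflation, and pullback/pushout classes are realized by actual pullback/pushout diagrams. -/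
structure YonedaExt (k : Type) [Field k] (C : Type u) [Category.{v} C] [Abelian C]
    [Linear k C] where
  ext : C → C → ModuleCat.{v} k
  pull : ∀ {X' X : C} (_ : X' ⟶ X) (Y : C), ext X Y →ₗ[k] ext X' Y
  push : ∀ (X : C) {Y Y' : C} (_ : Y ⟶ Y'), ext X Y →ₗ[k] ext X Y'
  pull_id : ∀ X Y : C, pull (𝟙 X) Y = LinearMap.id
  pull_comp : ∀ {X'' X' X : C} (f : X'' ⟶ X') (g : X' ⟶ X) (Y : C),
    pull (f ≫ g) Y = (pull f Y).comp (pull g Y)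
  pull_zero : ∀ (X' X Y : C), pull (0 : X' ⟶ X) Y = 0
  pull_add : ∀ {X' X : C} (f g : X' ⟶ X) (Y : C), pull (f + g) Y = pull f Y + pull g Y
  pull_smul : ∀ {X' X : C} (a : k) (f : X' ⟶ X) (Y : C), pull (a • f) Y = a • pull f Y
  push_id : ∀ X Y : C, push X (𝟙 Y) = LinearMap.id
  push_comp : ∀ (X : C) {Y Y' Y'' : C} (g : Y ⟶ Y') (g' : Y' ⟶ Y''),
    push X (g ≫ g') = (push X g').comp (push X g)
  push_zero : ∀ (X Y Y' : C), push X (0 : Y ⟶ Y') = 0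
  push_add : ∀ (X : C) {Y Y' : C} (g h : Y ⟶ Y'), push X (g + h) = push X g + push X h
  push_smul : ∀ (X : C) {Y Y' : C} (a : k) (g : Y ⟶ Y'), push X (a • g) = a • push X g
  pull_push : ∀ {X' X Y Y' : C} (f : X' ⟶ X) (g : Y ⟶ Y'),
    (push X' g).comp (pull f Y) = (pull f Y').comp (push X g)
  cls : ∀ {S : ShortComplex C}, S.ShortExact → ext S.X₃ S.X₁
  cls_eq_zero_iff : ∀ {S : ShortComplex C} (hS : S.ShortExact),
    cls hS = 0 ↔ Nonempty S.Splitting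
  cls_surjective : ∀ (X Y : C) (e : ext X Y), ∃ (E : C) (i : Y ⟶ E) (p : E ⟶ X)
    (w : i ≫ p = 0) (hS : (ShortComplex.mk i p w).ShortExact), cls hS = e
  cls_pull : ∀ {S : ShortComplex C} (hS : S.ShortExact) {Z : C} (f : Z ⟶ S.X₃),
    ∃ (E' : C) (i' : S.X₁ ⟶ E') (p' : E' ⟶ Z) (w' : i' ≫ p' = 0)
      (hS' : (ShortComplex.mk i' p' w').ShortExact) (m : E' ⟶ S.X₂),
      cls hS' = pull f S.X₁ (cls hS) ∧ i' ≫ m = S.f ∧ m ≫ S.g = p' ≫ f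
  cls_push : ∀ {S : ShortComplex C} (hS : S.ShortExact) {Z : C} (g : S.X₁ ⟶ Z),
    ∃ (E' : C) (i' : Z ⟶ E') (p' : E' ⟶ S.X₃) (w' : i' ≫ p' = 0)
      (hS' : (ShortComplex.mk i' p' w').ShortExact) (m : S.X₂ ⟶ E'),
      cls hS' = push S.X₃ g (cls hS) ∧ S.f ≫ m = g ≫ i' ∧ m ≫ p' = S.g

variable {k : Type} [Field k] {C : Type u} [Category.{v} C] [Abelian C] [Linear k C]

/-- The ideal of injectively trivial morphisms `M ⟶ X`, i.e. those `f` with `Ext(Z,f) = 0`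
for every `Z`. -/
def ITriv (T : YonedaExt k C) (M X : C) : Submodule k (M ⟶ X) where
  carrier := {f | ∀ Z : C, T.push Z f = 0}
  add_mem' := by
    intro f g hf hg Z
    rw [T.push_add, hf Z, hg Z, add_zero]
  zero_mem' := fun Z => T.push_zero Z _ _
  smul_mem' := by
    intro a f hf Z
    rw [T.push_smul, hf Z, smul_zero]

lemma mem_ITriv {T : YonedaExt k C} {M X : C} {f : M ⟶ X} :
    f ∈ ITriv T M X ↔ ∀ Z : C, T.push Z f = 0 := Iff.rfl

/-- The ideal of projectively trivial morphisms `M ⟶ X`, i.e. those `f` with `Ext(f,Z) = 0`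
for every `Z`. -/
def PTriv (T : YonedaExt k C) (M X : C) : Submodule k (M ⟶ X) where
  carrier := {f | ∀ Z : C, T.pull f Z = 0}
  add_mem' := by
    intro f g hf hg Z
    rw [T.pull_add, hf Z, hg Z, add_zero]
  zero_mem' := fun Z => T.pull_zero _ _ Z
  smul_mem' := by
    intro a f hf Z
    rw [T.pull_smul, hf Z, smul_zero]

lemma mem_PTriv {T : YonedaExt k C} {M X : C} {f : M ⟶ X} :
    f ∈ PTriv T M X ↔ ∀ Z : C, T.pull f Z = 0 := Iff.rfl

/-- Hom-spaces of the injectively stable category `C̄ = C/I`. -/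
abbrev HomBar (T : YonedaExt k C) (M X : C) := (M ⟶ X) ⧸ ITriv T M X

/-- Hom-spaces of the projectively stable category `C̲ = C/P`. -/
abbrev HomUnder (T : YonedaExt k C) (M X : C) := (M ⟶ X) ⧸ PTriv T M X

/-- `u : X ⟶ E` is left almost split: it is not a section, and every non-section
`X ⟶ Z` factors through it. -/
def IsLeftAlmostSplit {X E : C} (u : X ⟶ E) : Prop :=
  (¬ ∃ r : E ⟶ X, u ≫ r = 𝟙 X) ∧
  ∀ (Z : C) (f : X ⟶ Z), (¬ ∃ r : Z ⟶ X, f ≫ r = 𝟙 X) → ∃ h : E ⟶ Z, u ≫ h = f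

/-- `v : E ⟶ Y` is right almost split: it is not a retraction, and every non-retraction
`Z ⟶ Y` factors through it. -/
def IsRightAlmostSplit {E Y : C} (v : E ⟶ Y) : Prop :=
  (¬ ∃ s : Y ⟶ E, s ≫ v = 𝟙 Y) ∧
  ∀ (Z : C) (f : Z ⟶ Y), (¬ ∃ s : Y ⟶ Z, s ≫ f = 𝟙 Y) → ∃ h : Z ⟶ E, h ≫ v = f

/-- `X → E → Y` is an almost split conflation. -/
def IsAlmostSplitConflation {X E Y : C} (u : X ⟶ E) (v : E ⟶ Y) (w : u ≫ v = 0) : Prop :=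
  (ShortComplex.mk u v w).ShortExact ∧ IsLeftAlmostSplit u ∧ IsRightAlmostSplit v

/-- `Z` is a direct summand of `Y`. -/
def IsDirectSummand (Z Y : C) : Prop := ∃ (i : Z ⟶ Y) (r : Y ⟶ Z), i ≫ r = 𝟙 Z

/-- An indecomposable object. -/
def Indec (Y : C) : Prop :=
  ¬ IsZero Y ∧ ∀ A B : C, Nonempty (Y ≅ A ⊞ B) → IsZero A ∨ IsZero B

/-- Injective object of the exact category: every conflation starting at it splits,
equivalently `Ext(-,X)` vanishes. -/
def IsInjObj (T : YonedaExt k C) (X : C) : Prop := ∀ (Z : C) (e : T.ext Z X), e = 0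

/-- Projective object of the exact category: every conflation ending at it splits,
equivalently `Ext(X,-)` vanishes. -/
def IsProjObj (T : YonedaExt k C) (X : C) : Prop := ∀ (Z : C) (e : T.ext X Z), e = 0

/-- `Yt` represents the functor `D Ext(Y,-) : C̄ → k-Mod`, i.e. there is an isomorphism of
functors `Hom̄(-,Yt) ≅ D Ext(Y,-)`. -/
def RepresentsR (T : YonedaExt k C) (Y Yt : C) : Prop :=
  ∃ e : ∀ M : C, HomBar T M Yt ≃ₗ[k] Module.Dual k (T.ext Y M),
    ∀ (M M' : C) (h : M ⟶ M') (f : M' ⟶ Yt) (μ : T.ext Y M),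
      e M (Submodule.Quotient.mk (h ≫ f)) μ = e M' (Submodule.Quotient.mk f) (T.push Y h μ)

/-- `Xt` represents the functor `D Ext(-,X) : C̲ → k-Mod`, i.e. there is an isomorphism of
functors `Hom̲(Xt,-) ≅ D Ext(-,X)`. -/
def RepresentsL (T : YonedaExt k C) (X Xt : C) : Prop :=
  ∃ e : ∀ M : C, HomUnder T Xt M ≃ₗ[k] Module.Dual k (T.ext M X),
    ∀ (M M' : C) (h : M ⟶ M') (g : Xt ⟶ M) (μ : T.ext M' X),
      e M' (Submodule.Quotient.mk (g ≫ h)) μ = e M (Submodule.Quotient.mk g) (T.pull h X μ)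

/-- The full subcategory `C_r`: the functor `D Ext(X,-) : C̄ → k-Mod` is representable. -/
def MemCr (T : YonedaExt k C) (X : C) : Prop := ∃ Xt : C, RepresentsR T X Xt

/-- The full subcategory `C_l`: the functor `D Ext(-,X) : C̲ → k-Mod` is representable. -/
def MemCl (T : YonedaExt k C) (X : C) : Prop := ∃ Xt : C, RepresentsL T X Xt

/-- `X ≅ Y` in the projectively stable category `C̲`. -/
def StablyIsoP (T : YonedaExt k C) (X Y : C) : Prop :=
  ∃ (f : X ⟶ Y) (g : Y ⟶ X), f ≫ g - 𝟙 X ∈ PTriv T X X ∧ g ≫ f - 𝟙 Y ∈ PTriv T Y Y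

/-- `X ≅ Y` in the injectively stable category `C̄`. -/
def StablyIsoI (T : YonedaExt k C) (X Y : C) : Prop :=
  ∃ (f : X ⟶ Y) (g : Y ⟶ X), f ≫ g - 𝟙 X ∈ ITriv T X X ∧ g ≫ f - 𝟙 Y ∈ ITriv T Y Y

end GenAR
namespace GenAR

variable {k : Type} [Field k] {C : Type u} [Category.{v} C] [Abelian C] [Linear k C]

/-- The data of the generalized Auslander-Reiten translations: for each `Y ∈ C_r` a fixed
object `τY` together with a fixed natural isomorphism `φ_Y : Hom̄(-,τY) ≅ D Ext(Y,-)`, and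
for each `X ∈ C_l` a fixed object `τ⁻X` together with a fixed natural isomorphism
`ψ_X : Hom̲(τ⁻X,-) ≅ D Ext(-,X)`. -/
structure TranslationData (T : YonedaExt k C) where
  tau : ∀ Y : C, MemCr T Y → C
  phi : ∀ (Y : C) (hY : MemCr T Y) (M : C),
    HomBar T M (tau Y hY) ≃ₗ[k] Module.Dual k (T.ext Y M)
  phi_natural : ∀ (Y : C) (hY : MemCr T Y) (M M' : C) (h : M ⟶ M')
    (f : M' ⟶ tau Y hY) (μ : T.ext Y M),
    phi Y hY M (Submodule.Quotient.mk (h ≫ f)) μ =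
      phi Y hY M' (Submodule.Quotient.mk f) (T.push Y h μ)
  taum : ∀ X : C, MemCl T X → C
  psi : ∀ (X : C) (hX : MemCl T X) (M : C),
    HomUnder T (taum X hX) M ≃ₗ[k] Module.Dual k (T.ext M X)
  psi_natural : ∀ (X : C) (hX : MemCl T X) (M M' : C) (h : M ⟶ M')
    (g : taum X hX ⟶ M) (μ : T.ext M' X),
    psi X hX M' (Submodule.Quotient.mk (g ≫ h)) μ =
      psi X hX M (Submodule.Quotient.mk g) (T.pull h X μ)

variable {T : YonedaExt k C}

/-- `t : τY ⟶ τY'` represents the morphism `τ(f̲) : τY → τY'` in `C̄`, i.e. the unique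
morphism with `φ_{Y'} ∘ Hom̄(-,τ(f̲)) = D Ext(f,-) ∘ φ_Y`. -/
def IsTauMap (D : TranslationData T) {Y Y' : C} (hY : MemCr T Y) (hY' : MemCr T Y')
    (f : Y ⟶ Y') (t : D.tau Y hY ⟶ D.tau Y' hY') : Prop :=
  ∀ (M : C) (g : M ⟶ D.tau Y hY) (μ : T.ext Y' M),
    D.phi Y' hY' M (Submodule.Quotient.mk (g ≫ t)) μ =
      D.phi Y hY M (Submodule.Quotient.mk g) (T.pull f M μ)

/-- `s : τ⁻X ⟶ τ⁻X'` represents the morphism `τ⁻(ḡ) : τ⁻X → τ⁻X'` in `C̲`, i.e. the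
unique morphism with `ψ_X ∘ Hom̲(τ⁻(ḡ),-) = D Ext(-,g) ∘ ψ_{X'}`. -/
def IsTauMinusMap (D : TranslationData T) {X X' : C} (hX : MemCl T X) (hX' : MemCl T X')
    (g : X ⟶ X') (s : D.taum X hX ⟶ D.taum X' hX') : Prop :=
  ∀ (M : C) (h : D.taum X' hX' ⟶ M) (μ : T.ext M X),
    D.psi X hX M (Submodule.Quotient.mk (s ≫ h)) μ =
      D.psi X' hX' M (Submodule.Quotient.mk h) (T.push M g μ)

/-- The morphism `ε̲_Y = (ψ_{τY,Y})⁻¹(φ_{Y,τY}(Id̄_{τY})) : τ⁻τY → Y` in `C̲`. -/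
def epsClass (D : TranslationData T) (Y : C) (hY : MemCr T Y)
    (hτY : MemCl T (D.tau Y hY)) : HomUnder T (D.taum (D.tau Y hY) hτY) Y :=
  (D.psi (D.tau Y hY) hτY Y).symm
    (D.phi Y hY (D.tau Y hY) (Submodule.Quotient.mk (𝟙 (D.tau Y hY))))

/-- The morphism `η̄_X = (φ_{τ⁻X,X})⁻¹(ψ_{X,τ⁻X}(Id̲_{τ⁻X})) : X → ττ⁻X` in `C̄`. -/
def etaClass (D : TranslationData T) (X : C) (hX : MemCl T X)
    (hτX : MemCr T (D.taum X hX)) : HomBar T X (D.tau (D.taum X hX) hτX) :=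
  (D.phi (D.taum X hX) hτX X).symm
    (D.psi X hX (D.taum X hX) (Submodule.Quotient.mk (𝟙 (D.taum X hX))))

end GenAR
namespace GenAR

variable {k : Type} [Field k] {C : Type u} [Category.{v} C] [Abelian C] [Linear k C]

/-- **Lemma 3.5** (triangle identities).  For each `Y ∈ C̲_r`,
`τ(ε̲_Y) ∘ η̄_{τY} = Id̄_{τY}`, and for each `X ∈ C̄_l`,
`ε̲_{τ⁻X} ∘ τ⁻(η̄_X) = Id̲_{τ⁻X}`.  Hence `(τ⁻, τ)` is an adjoint pair with unit `η̄` and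
counit `ε̲`.  (Here `e` represents `ε̲_Y`, `t` represents `τ(ε̲_Y)`, `n` represents
`η̄_{τY}`; dually `m` represents `η̄_X`, `s` represents `τ⁻(η̄_X)`, `d` represents
`ε̲_{τ⁻X}`.) -/
theorem lemma_adjoint_pair
    (homFinite : ∀ X Y : C, FiniteDimensional k (X ⟶ Y))
    (T : YonedaExt k C) (D : TranslationData T) :
    (∀ (Y : C) (hY : MemCr T Y) (hτY : MemCl T (D.tau Y hY))
      (hττY : MemCr T (D.taum (D.tau Y hY) hτY))
      (e : D.taum (D.tau Y hY) hτY ⟶ Y),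
      Submodule.Quotient.mk e = epsClass D Y hY hτY →
      ∀ t : D.tau (D.taum (D.tau Y hY) hτY) hττY ⟶ D.tau Y hY,
        IsTauMap D hττY hY e t →
        ∀ n : D.tau Y hY ⟶ D.tau (D.taum (D.tau Y hY) hτY) hττY,
          Submodule.Quotient.mk n = etaClass D (D.tau Y hY) hτY hττY →
          (Submodule.Quotient.mk (n ≫ t) : HomBar T (D.tau Y hY) (D.tau Y hY)) =
            Submodule.Quotient.mk (𝟙 (D.tau Y hY))) ∧
    (∀ (X : C) (hX : MemCl T X) (hτX : MemCr T (D.taum X hX))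
      (hττX : MemCl T (D.tau (D.taum X hX) hτX))
      (m : X ⟶ D.tau (D.taum X hX) hτX),
      Submodule.Quotient.mk m = etaClass D X hX hτX →
      ∀ s : D.taum X hX ⟶ D.taum (D.tau (D.taum X hX) hτX) hττX,
        IsTauMinusMap D hX hττX m s →
        ∀ d : D.taum (D.tau (D.taum X hX) hτX) hττX ⟶ D.taum X hX,
          Submodule.Quotient.mk d = epsClass D (D.taum X hX) hτX hττX →
          (Submodule.Quotient.mk (s ≫ d) : HomUnder T (D.taum X hX) (D.taum X hX)) =
            Submodule.Quotient.mk (𝟙 (D.taum X hX))) := by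
  refine ⟨fun Y hY hτY hττY e he t ht n hn => ?_, fun X hX hτX hττX m hm s hs d hd => ?_⟩
  · apply (D.phi Y hY _).injective
    ext μ
    have h := D.psi_natural (D.tau Y hY) hτY _ _ e (𝟙 _) μ
    rw [Category.id_comp, he, epsClass, LinearEquiv.apply_symm_apply] at h
    rw [ht, hn, etaClass, LinearEquiv.apply_symm_apply, h]
  · apply (D.psi X hX _).injective
    ext μ
    have h := D.phi_natural (D.taum X hX) hτX _ _ m (𝟙 _) μ
    rw [Category.comp_id, hm, etaClass, LinearEquiv.apply_symm_apply] at h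
    rw [hs, hd, epsClass, LinearEquiv.apply_symm_apply, h]

end GenAR
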